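/- Suppose the Laplace transform R(s) = L[ρ](s) of a locally integrable function ρ : ℝ_+ → ℂ converges absolutely for Re(s) > σ₀ and extends holomorphically to Re(s) > −δ for some δ > 0 with sup_{Re(s) ≥ −δ/2} |R(s)|(1+|s|)² < ∞; then ρ agrees almost everywhere with a function satisfying |ρ(t)| ≤ C e^{−δ t /2} for some constant C. Conversely, if ρ(t) = e^{γ t} with γ > 0, then L[ρ](s) = 1/(s−γ) has a pole in the right half-plane. -/

import Mathlib

open MeasureTheory

/-- The Laplace transform in time, `L[F](s) = ∫₀^∞ e^{−st} F(t) dt`. -/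
noncomputable def laplace (F : ℝ → ℂ) (s : ℂ) : ℂ :=
  ∫ t in Set.Ioi (0 : ℝ), Complex.exp (-s * (t : ℂ)) * F t

open Filter Set Complex FourierTransform Topology

/-- **Fourier inversion, almost everywhere**: if `f` and its Fourier transform are both integrable,
then `f` agrees almost everywhere with the inverse Fourier transform of `𝓕 f`. -/
theorem ae_eq_fourierInv_fourier {V E : Type*} [NormedAddCommGroup V] [InnerProductSpace ℝ V]
    [FiniteDimensional ℝ V] [MeasurableSpace V] [BorelSpace V] [NormedAddCommGroup E]
    [NormedSpace ℂ E] [CompleteSpace E] {f : V → E} (hf : Integrable f)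
    (hf' : Integrable (𝓕 f)) : f =ᵐ[volume] 𝓕⁻ (𝓕 f) := by
  have hcont : Continuous (𝓕⁻ (𝓕 f)) :=
    VectorFourier.fourierIntegral_continuous Real.continuous_fourierChar
      (by simpa using! continuous_inner.neg) hf'
  refine ae_eq_of_integral_contDiff_smul_eq hf.locallyIntegrable hcont.locallyIntegrable
    fun g hg hgs ↦ ?_
  have hgs' : HasCompactSupport (fun x ↦ (g x : ℂ)) := hgs.comp_left Complex.ofReal_zero
  let φ : SchwartzMap V ℂ := hgs'.toSchwartzMap (Complex.ofRealCLM.contDiff.comp hg)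
  have hφ (x : V) (e : E) : φ x • e = g x • e := Complex.coe_smul (g x) e
  have hflip : (-innerₗ V).flip = -innerₗ V := by
    ext x y
    simp [real_inner_comm]
  have hinv : 𝓕 (𝓕⁻ (φ : V → ℂ)) = φ := by
    rw [← SchwartzMap.fourierInv_coe, ← SchwartzMap.fourier_coe,
      FourierTransform.fourier_fourierInv_eq]
  have hint : Integrable (𝓕⁻ (φ : V → ℂ)) := by
    rw [← SchwartzMap.fourierInv_coe]
    exact (𝓕⁻ φ).integrable
  calc ∫ x, g x • f x = ∫ x, φ x • f x := by simp_rw [hφ]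
    _ = ∫ x, 𝓕 (𝓕⁻ (φ : V → ℂ)) x • f x := by rw [hinv]
    _ = ∫ x, (𝓕⁻ (φ : V → ℂ)) x • 𝓕 f x := by
      simpa using! VectorFourier.integral_fourierIntegral_smul_eq_flip (L := innerₗ V)
        Real.continuous_fourierChar continuous_inner hint hf
    _ = ∫ x, φ x • 𝓕⁻ (𝓕 f) x := by
      simpa [hflip] using! VectorFourier.integral_fourierIntegral_smul_eq_flip
        (L := -innerₗ V) (μ := volume) (ν := volume) Real.continuous_fourierChar (by simpa using! continuous_inner.neg) φ.integrable hf'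
    _ = ∫ x, g x • 𝓕⁻ (𝓕 f) x := by simp_rw [hφ]

/-- The integral of a function holomorphic on a vertical strip is the same along both boundary
lines, provided the function tends to zero uniformly as `|Im s| → ∞` in the strip. -/
theorem integral_vertical_line_eq {E : Type*} [NormedAddCommGroup E] [NormedSpace ℂ E]
    {G : ℂ → E} {a b : ℝ} (hab : a ≤ b)
    (hG : DifferentiableOn ℂ G {s | s.re ∈ Icc a b})
    (ha : Integrable fun y : ℝ ↦ G (a + y * I)) (hb : Integrable fun y : ℝ ↦ G (b + y * I))
    {g : ℝ → ℝ} (hg : Tendsto g atTop (𝓝 0))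
    (hbound : ∀ s : ℂ, s.re ∈ Icc a b → ‖G s‖ ≤ g |s.im|) :
    ∫ y : ℝ, G (a + y * I) = ∫ y : ℝ, G (b + y * I) := by
  have hhor (c : ℝ → ℝ) (hc : ∀ᶠ T in atTop, |c T| = T) :
      Tendsto (fun T ↦ ∫ x in a..b, G (x + c T * I)) atTop (𝓝 0) := by
    refine squeeze_zero_norm' (a := fun T ↦ g T * |b - a|) ?_ (by simpa using hg.mul_const |b - a|)
    filter_upwards [hc] with T hT
    refine intervalIntegral.norm_integral_le_of_norm_le_const fun x hx ↦ ?_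
    rw [uIoc_of_le hab] at hx
    simpa [hT] using hbound (x + c T * I) (by simpa using Ioc_subset_Icc_self hx)
  have htop := hhor id (by filter_upwards [eventually_ge_atTop 0] with T hT using abs_of_nonneg hT)
  have hbot := hhor (fun T ↦ -T)
    (by filter_upwards [eventually_ge_atTop 0] with T hT using by rw [abs_neg, abs_of_nonneg hT])
  have hlim := ((hbot.sub htop).add
    ((intervalIntegral_tendsto_integral hb tendsto_neg_atTop_atBot tendsto_id).const_smul I)).sub
    ((intervalIntegral_tendsto_integral ha tendsto_neg_atTop_atBot tendsto_id).const_smul I)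
  have hrect (T : ℝ) := integral_boundary_rect_eq_zero_of_differentiableOn G (a + (-T : ℝ) * I)
    (b + T * I) (hG.mono fun s hs ↦ by simpa [uIcc_of_le hab] using hs.1)
  have hzero := tendsto_nhds_unique hlim (tendsto_const_nhds.congr fun T ↦ by
    simpa using (hrect T).symm)
  rw [sub_zero, zero_add, ← smul_sub, smul_eq_zero_iff_right I_ne_zero, sub_eq_zero] at hzero
  exact hzero.symm

/-- The Laplace transform on a vertical line is the Fourier transform of the damped function. -/
theorem fourier_damped_eq_laplace (F : ℝ → ℂ) (σ w : ℝ) :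
    𝓕 ((Ioi (0 : ℝ)).indicator fun t : ℝ ↦ cexp (-(σ : ℂ) * t) * F t) w =
      laplace F (σ + (2 * Real.pi * w : ℝ) * I) := by
  rw [Real.fourier_real_eq_integral_exp_smul, laplace, ← integral_indicator measurableSet_Ioi]
  congr 1 with t
  by_cases ht : t ∈ Ioi (0 : ℝ)
  · simp only [indicator_of_mem ht, smul_eq_mul, ← mul_assoc, ← Complex.exp_add]
    congr 2
    push_cast
    ring
  · simp [indicator_of_notMem ht]

/-- **Mellin inversion formula** for the Laplace transform: if `F` is absolutely Laplace
transformable at `σ`, with Laplace transform integrable along the line `Re s = σ`, then `F` is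
almost everywhere on `(0, ∞)` the inverse Laplace integral along that line. -/
theorem ae_eq_inverse_laplace {F : ℝ → ℂ} {σ : ℝ}
    (hF : IntegrableOn (fun t : ℝ ↦ cexp (-(σ : ℂ) * t) * F t) (Ioi 0))
    (hL : Integrable fun y : ℝ ↦ laplace F (σ + y * I)) :
    F =ᵐ[volume.restrict (Ioi (0 : ℝ))] fun t ↦
      (2 * Real.pi : ℂ)⁻¹ * ∫ y : ℝ, laplace F (σ + y * I) * cexp ((σ + y * I) * t) := by
  have hfourier : 𝓕 ((Ioi (0 : ℝ)).indicator fun t : ℝ ↦ cexp (-(σ : ℂ) * t) * F t) =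
      fun w : ℝ ↦ laplace F (σ + (2 * Real.pi * w : ℝ) * I) :=
    funext fun w ↦ fourier_damped_eq_laplace F σ w
  have hinv := ae_eq_fourierInv_fourier ((integrable_indicator_iff measurableSet_Ioi).2 hF)
    (by rw [hfourier]; exact hL.comp_mul_left' (by positivity))
  rw [hfourier] at hinv
  filter_upwards [ae_restrict_of_ae hinv, ae_restrict_mem measurableSet_Ioi] with t ht ht0
  rw [indicator_of_mem ht0, Real.fourierInv_eq'] at ht
  have hscale := Measure.integral_comp_mul_left
    (fun y : ℝ ↦ laplace F (σ + y * I) * cexp ((σ + y * I) * t)) (2 * Real.pi)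
  rw [abs_of_pos (by positivity), Complex.real_smul] at hscale
  push_cast at hscale
  rw [← hscale]
  calc F t = cexp (σ * t) * (cexp (-(σ : ℂ) * t) * F t) := by
        rw [← mul_assoc, ← Complex.exp_add]; simp
    _ = _ := by
      rw [ht, ← integral_const_mul]
      congr 1 with w
      rw [smul_eq_mul, ← mul_assoc, ← Complex.exp_add, mul_comm]
      simp only [RCLike.inner_apply, conj_trivial]
      push_cast
      congr 2
      ring

/-- A function that decays like `(1 + |s|)⁻²` decays like `(1 + (Im s)²)⁻¹` when multiplied by
`e^{st}`, on vertical lines. -/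
theorem norm_mul_cexp_le {z s : ℂ} {M t : ℝ} (h : ‖z‖ * (1 + ‖s‖) ^ 2 ≤ M) :
    ‖z * cexp (s * t)‖ ≤ M * Real.exp (s.re * t) * (1 + s.im ^ 2)⁻¹ := by
  have him : 1 + s.im ^ 2 ≤ (1 + ‖s‖) ^ 2 := by
    nlinarith [sq_le_sq' (neg_le_of_abs_le s.abs_im_le_norm) (le_of_abs_le s.abs_im_le_norm),
      norm_nonneg s]
  have hz : ‖z‖ ≤ M * (1 + s.im ^ 2)⁻¹ := by
    rw [← div_eq_mul_inv, le_div_iff₀ (by positivity)]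
    exact (by gcongr : _ ≤ _).trans h
  rw [norm_mul, Complex.norm_exp, re_mul_ofReal, mul_right_comm]
  gcongr

theorem laplace_cexp {γ s : ℂ} (h : γ.re < s.re) :
    laplace (fun t ↦ cexp (γ * t)) s = 1 / (s - γ) := by
  have hre : (γ - s).re < 0 := by simpa using h
  calc laplace (fun t ↦ cexp (γ * t)) s = ∫ t : ℝ in Ioi 0, cexp ((γ - s) * t) := by
        simp only [laplace, ← Complex.exp_add]
        congr 1 with t
        ring_nf
    _ = 1 / (s - γ) := by
      rw [integral_exp_mul_complex_Ioi hre, ← neg_sub s γ, neg_div_neg_eq]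
      simp

theorem tendsto_norm_one_div_sub (γ : ℂ) :
    Tendsto (fun s : ℂ ↦ ‖1 / (s - γ)‖) (𝓝[≠] γ) atTop := by
  have hsub : Tendsto (fun s : ℂ ↦ s - γ) (𝓝[≠] γ) (𝓝[≠] 0) := by
    refine tendsto_nhdsWithin_iff.2 ⟨?_, ?_⟩
    · exact ((by fun_prop : Continuous fun s : ℂ ↦ s - γ).tendsto' γ 0 (sub_self γ)).mono_left
        nhdsWithin_le_nhds
    · filter_upwards [self_mem_nhdsWithin] with s hs using sub_ne_zero.2 hs
  simpa [Function.comp_def] using (tendsto_norm_inv_nhdsNE_zero_atTop (α := ℂ)).comp hsub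

/-- (i) If the Laplace transform `R = L[ρ]` of a locally integrable `ρ : ℝ₊ → ℂ`
converges absolutely for `Re(s) > σ₀` and extends holomorphically to `Re(s) > −δ`
with `sup_{Re(s) ≥ −δ/2} |R(s)|(1+|s|)² < ∞`, then `ρ` agrees a.e. on `(0,∞)` with a
function bounded by `C e^{−δt/2}`. (ii) Conversely, for `ρ(t) = e^{γt}` with `γ > 0`,
the Laplace transform equals `1/(s−γ)` for `Re(s) > γ` and has a pole at `γ` in the
right half-plane. -/
theorem laplace_decay_and_pole
    (ρ : ℝ → ℂ) (σ₀ δ M : ℝ) (hδ : 0 < δ)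
    (hρ_loc : LocallyIntegrableOn ρ (Set.Ici 0))
    (habs : ∀ s : ℂ, σ₀ < s.re →
      IntegrableOn (fun t : ℝ => Complex.exp (-s * (t : ℂ)) * ρ t) (Set.Ioi 0))
    (R : ℂ → ℂ)
    (hR_holo : DifferentiableOn ℂ R {s : ℂ | -δ < s.re})
    (hR_ext : ∀ s : ℂ, σ₀ < s.re → R s = laplace ρ s)
    (hR_bound : ∀ s : ℂ, -δ / 2 ≤ s.re → ‖R s‖ * (1 + ‖s‖) ^ 2 ≤ M) :
    (∃ (C : ℝ) (ρ' : ℝ → ℂ),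
        (ρ =ᵐ[volume.restrict (Set.Ioi (0 : ℝ))] ρ') ∧
        ∀ t : ℝ, 0 ≤ t → ‖ρ' t‖ ≤ C * Real.exp (-δ * t / 2))
    ∧ (∀ γ : ℝ, 0 < γ →
        (∀ s : ℂ, γ < s.re →
          laplace (fun t => Complex.exp ((γ : ℂ) * (t : ℂ))) s = 1 / (s - (γ : ℂ)))
        ∧ (0 : ℝ) < (γ : ℂ).re
        ∧ Filter.Tendsto (fun s : ℂ => ‖(1 : ℂ) / (s - (γ : ℂ))‖)
            (nhdsWithin (γ : ℂ) {(γ : ℂ)}ᶜ) Filter.atTop) := by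
  refine ⟨?_, fun γ hγ ↦ ⟨fun s hs ↦ laplace_cexp (by simpa using hs), by simpa using hγ,
    tendsto_norm_one_div_sub γ⟩⟩
  obtain ⟨σ, hσ₀, hσ⟩ : ∃ σ, σ₀ < σ ∧ -δ / 2 ≤ σ :=
    ⟨max (σ₀ + 1) (-δ / 2), (lt_add_one σ₀).trans_le (le_max_left _ _), le_max_right _ _⟩
  have hstrip : {s : ℂ | s.re ∈ Icc (-δ / 2) σ} ⊆ {s : ℂ | -δ < s.re} := fun s hs ↦ by
    have := hs.1
    rw [mem_ofPred_eq]
    linarith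
  have hM : 0 ≤ M := le_trans (by positivity) (hR_bound 0 (by simp; linarith))
  have hbound (t : ℝ) (s : ℂ) (hs : -δ / 2 ≤ s.re) :=
    norm_mul_cexp_le (t := t) (hR_bound s hs)
  have hdiff (t : ℝ) : DifferentiableOn ℂ (fun s ↦ R s * cexp (s * t)) {s | -δ < s.re} :=
    hR_holo.mul (by fun_prop)
  have hint (t x : ℝ) (hx : -δ / 2 ≤ x) :
      Integrable fun y : ℝ ↦ R (x + y * I) * cexp ((x + y * I) * t) := by
    refine (integrable_inv_one_add_sq.const_mul (M * Real.exp (x * t))).mono'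
      (Continuous.aestronglyMeasurable ?_) (ae_of_all _ fun y ↦ ?_)
    · exact (hdiff t).continuousOn.comp_continuous (f := fun y : ℝ ↦ (x + y * I : ℂ))
        (by fun_prop) fun y ↦ by simp; linarith
    · simpa using hbound t (x + y * I) (by simpa using hx)
  have hR_line (y : ℝ) : laplace ρ (σ + y * I) = R (σ + y * I) :=
    (hR_ext _ (by simpa using hσ₀)).symm
  have hinv := ae_eq_inverse_laplace (habs σ (by simpa using hσ₀))
    (by simpa [hR_line] using hint 0 σ hσ)
  simp only [hR_line] at hinv
  refine ⟨M / 2, fun t ↦ (2 * Real.pi : ℂ)⁻¹ *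
    ∫ y : ℝ, R ((-δ / 2 : ℝ) + y * I) * cexp (((-δ / 2 : ℝ) + y * I) * t), ?_, fun t _ ↦ ?_⟩
  · filter_upwards [hinv, ae_restrict_mem measurableSet_Ioi] with t ht ht0
    rw [ht]
    congr 1
    refine (integral_vertical_line_eq hσ ((hdiff t).mono hstrip) (hint t _ le_rfl) (hint t σ hσ)
      (g := fun y ↦ M * Real.exp (σ * t) * (1 + y ^ 2)⁻¹) ?_ fun s hs ↦ ?_).symm
    · have hdecay : Tendsto (fun y : ℝ ↦ (1 + y ^ 2)⁻¹) atTop (𝓝 0) :=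
        (tendsto_const_nhds.add_atTop (tendsto_pow_atTop two_ne_zero)).inv_tendsto_atTop
      simpa using hdecay.const_mul (M * Real.exp (σ * t))
    · refine (hbound t s hs.1).trans ?_
      rw [sq_abs]
      have := mul_le_mul_of_nonneg_right hs.2 (le_of_lt ht0)
      gcongr
  · have hnorm := norm_integral_le_of_norm_le
      (f := fun y : ℝ ↦ R ((-δ / 2 : ℝ) + y * I) * cexp (((-δ / 2 : ℝ) + y * I) * t))
      (integrable_inv_one_add_sq.const_mul (M * Real.exp (-δ / 2 * t)))
      (ae_of_all volume fun y : ℝ ↦ by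
        simpa using hbound t ((-δ / 2 : ℝ) + y * I) (by simp))
    rw [integral_const_mul, integral_univ_inv_one_add_sq] at hnorm
    rw [norm_mul, norm_inv, norm_mul, Complex.norm_ofNat, Complex.norm_real,
      Real.norm_of_nonneg Real.pi_pos.le, inv_mul_le_iff₀ (by positivity)]
    refine (le_of_eq_of_le (by push_cast; rfl) hnorm).trans_eq ?_
    rw [show -δ * t / 2 = -δ / 2 * t by ring]
    ring
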